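/- For every real r > 0 there exists a constant C(r) > 0 (depending only on r and the distribution of ξ) such that for all integers k ≥ 0 and n ≥ 1 (with P(|𝒯| = n) > 0), E [Z_k(T_n)^r] ≤ C(r) n^{r/2}. -/

import Mathlib

open scoped ENNReal BigOperators
open Set Filter

/-- Plane (ordered rooted) trees. -/
inductive PlaneTree : Type
  | node : List PlaneTree → PlaneTree

namespace PlaneTree

/-- The list of subtrees hanging off the root. -/
def children : PlaneTree → List PlaneTree
  | .node ts => ts

/-- The subtree rooted at a given position (sequence of child indices), if it exists. -/
def subtreeAt : PlaneTree → List ℕ → Option PlaneTree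
  | t, [] => some t
  | .node ts, i :: q =>
    match ts[i]? with
    | some t' => subtreeAt t' q
    | none => none

/-- The vertex set of a tree, with vertices identified with their positions. -/
def vertexSet (t : PlaneTree) : Set (List ℕ) := {q | (subtreeAt t q).isSome}

/-- The number of vertices of a tree. -/
noncomputable def size (t : PlaneTree) : ℕ := (vertexSet t).ncard

/-- The number of children of the vertex at position `q`. -/
def childCount (t : PlaneTree) (q : List ℕ) : ℕ :=
  ((subtreeAt t q).map fun t' => t'.children.length).getD 0

end PlaneTree

/-- Longest common prefix of two positions; this is the position of the last common
ancestor of the two vertices. -/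
def lca : List ℕ → List ℕ → List ℕ
  | a :: as, b :: bs => if a = b then a :: lca as bs else []
  | _, _ => []

/-- The distance from `v` up to the last common ancestor of `v` and `w`. -/
def dUp (v w : List ℕ) : ℕ := v.length - (lca v w).length

/-- The graph distance between the vertices at positions `v` and `w`. -/
def treeDist (v w : List ℕ) : ℕ := dUp v w + dUp w v

/-- The Galton–Watson probability of a given finite tree: the product, over all vertices,
of the probability that the offspring distribution takes the value given by the number of
children of the vertex. -/
noncomputable def gwProb (p : ℕ → ℝ≥0∞) (t : PlaneTree) : ℝ≥0∞ :=
  ∏ᶠ v ∈ PlaneTree.vertexSet t, p (PlaneTree.childCount t v)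

/-- `P(|𝒯| = n)` for the Galton–Watson tree `𝒯`. -/
noncomputable def probSize (p : ℕ → ℝ≥0∞) (n : ℕ) : ℝ≥0∞ :=
  ∑' t : PlaneTree, if PlaneTree.size t = n then gwProb p t else 0

/-- `E f(T_n)` where `T_n` is the Galton–Watson tree conditioned to have `n` vertices. -/
noncomputable def condExp (p : ℕ → ℝ≥0∞) (n : ℕ) (f : PlaneTree → ℝ≥0∞) : ℝ≥0∞ :=
  (∑' t : PlaneTree, if PlaneTree.size t = n then gwProb p t * f t else 0) / probSize p n

/-- The variance of the offspring distribution `p` (which has mean `1`). -/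
noncomputable def xiVar (p : ℕ → ℝ≥0∞) : ℝ≥0∞ :=
  ∑' k : ℕ, p k * ENNReal.ofReal (((k : ℝ) - 1) ^ 2)

/-- `P_k(t)`: the number of unordered pairs of vertices of `t` at graph distance `k`. -/
noncomputable def pairCount (t : PlaneTree) (k : ℕ) : ℕ :=
  {s : Set (List ℕ) | ∃ v w, v ∈ PlaneTree.vertexSet t ∧ w ∈ PlaneTree.vertexSet t ∧
    s = {v, w} ∧ treeDist v w = k}.ncard

/-- `Z_k(t)`: the number of vertices of `t` at graph distance `k` from the root. -/
noncomputable def levelCount (t : PlaneTree) (k : ℕ) : ℕ :=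
  {v | v ∈ PlaneTree.vertexSet t ∧ v.length = k}.ncard

namespace PlaneTree

lemma vertexSet_node (ts : List PlaneTree) :
    vertexSet (.node ts) =
      insert [] (⋃ i : Fin ts.length, List.cons (i : ℕ) '' vertexSet ts[i]) := by
  ext q
  cases q with
  | nil => simp [vertexSet, subtreeAt]
  | cons i q =>
    simp only [vertexSet, mem_ofPred_eq, subtreeAt, mem_insert_iff, reduceCtorEq, mem_iUnion,
      mem_image, List.cons.injEq, false_or]
    constructor
    · intro h
      by_cases hi : i < ts.length
      · refine ⟨⟨i, hi⟩, q, ?_, rfl, rfl⟩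
        simpa [List.getElem?_eq_getElem hi] using h
      · simp [List.getElem?_eq_none (not_lt.1 hi)] at h
    · rintro ⟨j, q', h, rfl, rfl⟩
      simpa [List.getElem?_eq_getElem j.2] using h

lemma vertexSet_finite : (t : PlaneTree) → (vertexSet t).Finite
  | .node ts => by
    rw [vertexSet_node]
    refine (Set.finite_iUnion fun i => ?_).insert _
    exact (vertexSet_finite ts[i]).image _
  termination_by t => sizeOf t
  decreasing_by
    have := List.sizeOf_lt_of_mem (List.getElem_mem i.2)
    simp only [Fin.getElem_fin, node.sizeOf_spec]
    omega

@[to_additive]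
lemma finprod_vertexSet_node {M : Type*} [CommMonoid M] (ts : List PlaneTree)
    (g : List ℕ → M) :
    ∏ᶠ v ∈ vertexSet (.node ts), g v =
      g [] * ∏ i : Fin ts.length, ∏ᶠ v ∈ vertexSet ts[i], g ((i : ℕ) :: v) := by
  have hfin (i : Fin ts.length) : (List.cons (i : ℕ) '' vertexSet ts[i]).Finite :=
    (vertexSet_finite _).image _
  rw [vertexSet_node, finprod_mem_insert _ (by simp) (Set.finite_iUnion hfin),
    finprod_mem_iUnion _ hfin, finprod_eq_prod_of_fintype]
  · congr 1
    refine Finset.prod_congr rfl fun i _ => ?_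
    rw [finprod_mem_image (List.cons_injective.injOn)]
  · intro i j hij
    refine Set.disjoint_left.2 ?_
    rintro _ ⟨v, -, rfl⟩ ⟨w, -, h⟩
    simp only [List.cons.injEq] at h
    exact hij (Fin.ext h.1.symm)

lemma size_eq_finsum (t : PlaneTree) : size t = ∑ᶠ _v ∈ vertexSet t, 1 := by
  rw [finsum_mem_eq_finite_toFinset_sum _ (vertexSet_finite t), size,
    Set.ncard_eq_toFinset_card _ (vertexSet_finite t), Finset.card_eq_sum_ones]

lemma levelCount_eq_finsum (t : PlaneTree) (k : ℕ) :
    levelCount t k = ∑ᶠ v ∈ vertexSet t, if v.length = k then 1 else 0 := by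
  rw [finsum_mem_eq_finite_toFinset_sum _ (vertexSet_finite t), ← Finset.card_filter, levelCount,
    ← Set.ncard_coe_finset]
  simp

lemma size_node (ts : List PlaneTree) : size (.node ts) = 1 + (ts.map size).sum := by
  rw [size_eq_finsum, finsum_vertexSet_node, ← Fin.sum_univ_fun_getElem]
  simp [size_eq_finsum]

lemma levelCount_zero (t : PlaneTree) : levelCount t 0 = 1 := by
  cases t with
  | node ts =>
    rw [levelCount_eq_finsum, finsum_vertexSet_node]
    simp

lemma levelCount_node_succ (ts : List PlaneTree) (k : ℕ) :
    levelCount (.node ts) (k + 1) = (ts.map fun t => levelCount t k).sum := by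
  rw [levelCount_eq_finsum, finsum_vertexSet_node, ← Fin.sum_univ_fun_getElem]
  simp [levelCount_eq_finsum]

lemma gwProb_node (p : ℕ → ℝ≥0∞) (ts : List PlaneTree) :
    gwProb p (.node ts) = p ts.length * (ts.map (gwProb p)).prod := by
  rw [gwProb, finprod_vertexSet_node, ← Fin.prod_univ_fun_getElem]
  congr 1
  refine Finset.prod_congr rfl fun i _ => ?_
  refine finprod_mem_congr rfl fun v _ => ?_
  simp [childCount, subtreeAt]

/-- The bijection between plane trees and finite sequences of plane trees. -/
def equivList : List PlaneTree ≃ PlaneTree where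
  toFun := .node
  invFun := children
  left_inv _ := rfl
  right_inv | .node _ => rfl

end PlaneTree

/-- Convolution of a function on an additive monoid with the image under `φ` of the weights `w`:
the expectation of `h (x + φ τ)` when `τ` is distributed according to `w`. -/
noncomputable def treeConv {M : Type*} [AddCommMonoid M] (w : PlaneTree → ℝ≥0∞)
    (φ : PlaneTree → M) (h : M → ℝ≥0∞) : M → ℝ≥0∞ :=
  fun x => ∑' t, w t * h (x + φ t)

section treeConv

variable {M : Type*} [AddCommMonoid M] (w : PlaneTree → ℝ≥0∞)

lemma treeConv_commute (φ ψ : PlaneTree → M) :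
    Function.Commute (treeConv w φ) (treeConv w ψ) := by
  intro h
  ext x
  simp only [treeConv, ← ENNReal.tsum_mul_left]
  rw [ENNReal.tsum_comm]
  refine tsum_congr fun t => tsum_congr fun s => ?_
  rw [add_right_comm, mul_left_comm]

lemma tsum_list_length_eq (φ : PlaneTree → M) (h : M → ℝ≥0∞) (i : ℕ) (x : M) :
    ∑' ts : List PlaneTree,
      (if ts.length = i then (ts.map w).prod * h (x + (ts.map φ).sum) else 0) =
      (treeConv w φ)^[i] h x := by
  induction i generalizing x with
  | zero =>
    rw [tsum_eq_single []]
    · simp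
    · intro ts hts
      simp [hts]
  | succ i ih =>
    rw [Function.iterate_succ_apply', treeConv]
    simp_rw [← ih, ← ENNReal.tsum_mul_left]
    rw [← ENNReal.tsum_prod]
    have hinj : Function.Injective (fun q : PlaneTree × List PlaneTree => q.1 :: q.2) := by
      rintro ⟨a, b⟩ ⟨c, d⟩ h
      simpa using h
    rw [← hinj.tsum_eq]
    · refine tsum_congr fun q => ?_
      simp [mul_assoc, add_assoc]
    · intro ts hts
      cases ts with
      | nil => simp at hts
      | cons t ts => exact ⟨(t, ts), rfl⟩

lemma tsum_list_eq (φ : PlaneTree → M) (h : M → ℝ≥0∞) (c : ℕ → ℝ≥0∞) (x : M) :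
    ∑' ts : List PlaneTree, c ts.length * ((ts.map w).prod * h (x + (ts.map φ).sum)) =
      ∑' i, c i * (treeConv w φ)^[i] h x := by
  simp_rw [← tsum_list_length_eq, ← ENNReal.tsum_mul_left]
  rw [ENNReal.tsum_comm]
  refine tsum_congr fun ts => ?_
  rw [tsum_eq_single ts.length]
  · simp
  · intro i hi
    simp [hi.symm]

end treeConv

/-- Removing the root of a Galton–Watson tree: if `φ` of a tree is `e` plus the sum of `ψ` over
the subtrees of the root, then `φ`-convolution is a mixture of iterated `ψ`-convolutions. -/
lemma treeConv_gwProb_eq {M : Type*} [AddCommMonoid M] (p : ℕ → ℝ≥0∞) (φ ψ : PlaneTree → M)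
    (e : M) (hφ : ∀ ts, φ (.node ts) = e + (ts.map ψ).sum) (h : M → ℝ≥0∞) (x : M) :
    treeConv (gwProb p) φ h x = ∑' i, p i * (treeConv (gwProb p) ψ)^[i] h (x + e) := by
  rw [← tsum_list_eq, treeConv, ← PlaneTree.equivList.tsum_eq]
  refine tsum_congr fun ts => ?_
  change gwProb p (.node ts) * h (x + φ (.node ts)) = _
  rw [PlaneTree.gwProb_node, hφ, mul_assoc, add_assoc]

/-- Convolution with the joint law of the size and of the `k`-th level count of a
Galton–Watson tree. -/
noncomputable def levelConv (p : ℕ → ℝ≥0∞) (k : ℕ) : (ℕ × ℕ → ℝ≥0∞) → ℕ × ℕ → ℝ≥0∞ :=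
  treeConv (gwProb p) fun t => (PlaneTree.size t, levelCount t k)

/-- Convolution with the law of the size of a Galton–Watson tree. -/
noncomputable def sizeConv (p : ℕ → ℝ≥0∞) : (ℕ → ℝ≥0∞) → ℕ → ℝ≥0∞ :=
  treeConv (gwProb p) PlaneTree.size

lemma List.sum_map_prodMk {α : Type*} (l : List α) (f g : α → ℕ) :
    (l.map fun a => (f a, g a)).sum = ((l.map f).sum, (l.map g).sum) := by
  induction l with
  | nil => rfl
  | cons a l ih => simp [ih]

lemma levelConv_succ_apply (p : ℕ → ℝ≥0∞) (k : ℕ) (h : ℕ × ℕ → ℝ≥0∞) (s z : ℕ) :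
    levelConv p (k + 1) h (s, z) = ∑' i, p i * (levelConv p k)^[i] h (s + 1, z) := by
  refine treeConv_gwProb_eq p _ _ (1, 0) (fun ts => ?_) h (s, z)
  rw [PlaneTree.size_node, PlaneTree.levelCount_node_succ, List.sum_map_prodMk]
  simp

lemma sizeConv_apply (p : ℕ → ℝ≥0∞) (h : ℕ → ℝ≥0∞) (s : ℕ) :
    sizeConv p h s = ∑' i, p i * (sizeConv p)^[i] h (s + 1) :=
  treeConv_gwProb_eq p _ _ 1 PlaneTree.size_node h s

/-- For a critical offspring distribution, a bound which is linear in the number of trees of a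
forest propagates from the level zero to all levels. -/
lemma levelConv_iterate_le (p : ℕ → ℝ≥0∞) (hp : ∑' k, p k = 1)
    (hmean : ∑' k : ℕ, (k : ℝ≥0∞) * p k = 1) (h : ℕ × ℕ → ℝ≥0∞) (B : ℝ≥0∞)
    (h0 : ∀ m s, (levelConv p 0)^[m] h (s, 0) ≤ m * B) (k m s : ℕ) :
    (levelConv p k)^[m] h (s, 0) ≤ m * B := by
  induction k generalizing m s with
  | zero => exact h0 m s
  | succ k ih =>
    suffices H : ∀ a b s, (levelConv p (k + 1))^[a] ((levelConv p k)^[b] h) (s, 0) ≤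
        (a + b : ℕ) * B by simpa using H m 0 s
    intro a
    induction a with
    | zero => intro b s; simpa using ih b s
    | succ a iha =>
      intro b s
      rw [Function.iterate_succ_apply', levelConv_succ_apply]
      have hcomm (i : ℕ) : Function.Commute (levelConv p k)^[i] (levelConv p (k + 1))^[a] :=
        (treeConv_commute _ _ _).iterate_iterate _ _
      calc ∑' i, p i * (levelConv p k)^[i]
            ((levelConv p (k + 1))^[a] ((levelConv p k)^[b] h)) (s + 1, 0)
          ≤ ∑' i, p i * ((a + (i + b) : ℕ) * B) := by
            refine ENNReal.tsum_le_tsum fun i => ?_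
            gcongr
            rw [hcomm i, ← Function.iterate_add_apply]
            exact iha _ _
        _ = ∑' i, (i * p i * B + p i * ((a + b : ℕ) * B)) := by
            refine tsum_congr fun i => ?_
            push_cast
            ring
        _ = (a + 1 + b : ℕ) * B := by
            rw [ENNReal.tsum_add, ENNReal.tsum_mul_right, ENNReal.tsum_mul_right, hp, hmean]
            push_cast
            ring

lemma levelConv_zero_iterate (p : ℕ → ℝ≥0∞) (a b : ℕ → ℝ≥0∞) (m s z : ℕ) :
    (levelConv p 0)^[m] (fun x => a x.1 * b x.2) (s, z) = (sizeConv p)^[m] a s * b (z + m) := by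
  induction m generalizing s z with
  | zero => rfl
  | succ m ih =>
    rw [Function.iterate_succ_apply', Function.iterate_succ_apply', levelConv, treeConv, sizeConv,
      treeConv, ← ENNReal.tsum_mul_right]
    refine tsum_congr fun t => ?_
    rw [Prod.mk_add_mk, PlaneTree.levelCount_zero, mul_assoc]
    change _ * (levelConv p 0)^[m] _ _ = _ * ((sizeConv p)^[m] _ _ * _)
    rw [ih, add_assoc, add_comm 1 m]

open PowerSeries in
lemma PowerSeries.coeff_pow_succ_mul_natCast {R : Type*} [CommSemiring R] (f : PowerSeries R)
    (N j : ℕ) :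
    (j : R) * coeff j (f ^ (N + 1)) =
      (N + 1) * ∑ i ∈ Finset.range (j + 1), i * coeff i f * coeff (j - i) (f ^ N) := by
  cases j with
  | zero => simp
  | succ j =>
    have h := congrArg (coeff j) (derivative_pow f (N + 1))
    rw [coeff_derivative, Nat.add_sub_cancel, mul_assoc, ← map_natCast (C (R := R)),
      coeff_C_mul, mul_comm (f ^ N), coeff_mul,
      Finset.Nat.sum_antidiagonal_eq_sum_range_succ
        (fun a b => coeff a (derivative R f) * coeff b (f ^ N))] at h
    rw [Finset.sum_range_succ', mul_comm]
    push_cast at h ⊢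
    rw [h]
    simp only [coeff_derivative, zero_mul, add_zero]
    congr 1
    refine Finset.sum_congr rfl fun i _ => ?_
    ring

/-- The indicator function of a natural number. -/
noncomputable def indicatorNat (n : ℕ) : ℕ → ℝ≥0∞ := fun s => if s = n then 1 else 0

lemma sizeConv_iterate_succ (p : ℕ → ℝ≥0∞) (h : ℕ → ℝ≥0∞) (m s : ℕ) :
    (sizeConv p)^[m + 1] h s = ∑' i, p i * (sizeConv p)^[i + m] h (s + 1) := by
  rw [Function.iterate_succ_apply', sizeConv_apply]
  simp_rw [Function.iterate_add_apply]

lemma PlaneTree.size_pos (t : PlaneTree) : 0 < PlaneTree.size t := by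
  cases t with
  | node ts => rw [PlaneTree.size_node]; omega

lemma sizeConv_iterate_indicatorNat_eq_zero (p : ℕ → ℝ≥0∞) {n m s : ℕ} (h : n < s + m) :
    (sizeConv p)^[m] (indicatorNat n) s = 0 := by
  induction m generalizing s with
  | zero => simp only [Function.iterate_zero, id_eq, indicatorNat]; rw [if_neg (by omega)]
  | succ m ih =>
    rw [Function.iterate_succ_apply', sizeConv, treeConv]
    simp only [ENNReal.tsum_eq_zero, mul_eq_zero]
    intro t
    have := t.size_pos
    exact Or.inr (ih (by omega))

open PowerSeries in
/-- The Otter–Dwass formula: the probability that a Galton–Watson forest of `m` trees has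
`m + j` vertices is `m / (m + j)` times the probability that a sum of `m + j` independent
offspring numbers equals `j`. -/
lemma sizeConv_iterate_indicatorNat (p : ℕ → ℝ≥0∞) (m j s : ℕ) :
    ((m + j : ℕ) : ℝ≥0∞) * (sizeConv p)^[m] (indicatorNat (s + (m + j))) s =
      m * coeff j (mk p ^ (m + j)) := by
  obtain ⟨l, hl⟩ : ∃ l, l = m + j := ⟨_, rfl⟩
  induction l generalizing m j s with
  | zero =>
    obtain ⟨rfl, rfl⟩ : m = 0 ∧ j = 0 := by omega
    simp
  | succ l ih =>
    cases m with
    | zero => simp [indicatorNat]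
    | succ m =>
      obtain rfl : l = m + j := by omega
      set F := (sizeConv p)^[m + 1] (indicatorNat (s + (m + 1 + j))) s with hF
      have hsum : F = ∑ i ∈ Finset.range (j + 1),
          p i * (sizeConv p)^[i + m] (indicatorNat (s + (m + 1 + j))) (s + 1) := by
        rw [hF, sizeConv_iterate_succ, tsum_eq_sum]
        intro i hi
        rw [sizeConv_iterate_indicatorNat_eq_zero p (by simp at hi; omega), mul_zero]
      rw [show m + 1 + j = m + j + 1 by omega]
      rcases Nat.eq_zero_or_pos (m + j) with h0 | h0
      · obtain ⟨rfl, rfl⟩ : m = 0 ∧ j = 0 := by omega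
        rw [hsum]
        simp [indicatorNat]
      have hmul : ((m + j : ℕ) : ℝ≥0∞) * F = ∑ i ∈ Finset.range (j + 1),
          (m * (p i * coeff (j - i) (mk p ^ (m + j))) +
            i * p i * coeff (j - i) (mk p ^ (m + j))) := by
        rw [hsum, Finset.mul_sum]
        refine Finset.sum_congr rfl fun i hi => ?_
        have hij : i ≤ j := by simp at hi; omega
        have := ih (i + m) (j - i) (s + 1) (by omega)
        rw [show i + m + (j - i) = m + j by omega,
          show s + 1 + (m + j) = s + (m + 1 + j) by omega] at this
        rw [mul_left_comm, this]
        push_cast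
        ring
      have hconv : ∑ i ∈ Finset.range (j + 1), p i * coeff (j - i) (mk p ^ (m + j)) =
          coeff j (mk p ^ (m + j + 1)) := by
        rw [pow_succ', coeff_mul, Finset.Nat.sum_antidiagonal_eq_sum_range_succ
          (fun a b => coeff a (mk p) * coeff b (mk p ^ (m + j)))]
        simp
      have hder := coeff_pow_succ_mul_natCast (mk p) (m + j) j
      simp only [coeff_mk] at hder
      rw [Finset.sum_add_distrib, ← Finset.mul_sum, hconv] at hmul
      refine (ENNReal.mul_right_inj (a := ((m + j : ℕ) : ℝ≥0∞)) (by exact_mod_cast h0.ne')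
        (ENNReal.natCast_ne_top _)).1 ?_
      calc ((m + j : ℕ) : ℝ≥0∞) * ((m + j + 1 : ℕ) * F)
          = (m + j + 1 : ℕ) * ((m + j : ℕ) * F) := by ring
        _ = (m + j + 1 : ℕ) * m * coeff j (mk p ^ (m + j + 1)) +
            j * coeff j (mk p ^ (m + j + 1)) := by
            rw [hmul, hder, mul_add]
            push_cast
            ring
        _ = _ := by
            push_cast
            ring

/-- A non-degenerate critical offspring distribution with finite variance. -/
structure IsCriticalOffspring (p : ℕ → ℝ) : Prop where
  nonneg : ∀ k, 0 ≤ p k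
  hasSum_one : HasSum p 1
  hasSum_mean : HasSum (fun k : ℕ => k * p k) 1
  summable_sq : Summable fun k : ℕ => p k * ((k : ℝ) - 1) ^ 2
  exists_ne_one : ∃ k, k ≠ 1 ∧ p k ≠ 0

/-- The generating function of a sequence. -/
noncomputable def genFun (p : ℕ → ℝ) (z : ℂ) : ℂ := ∑' k, (p k : ℂ) * z ^ k

namespace IsCriticalOffspring

open PowerSeries Complex

variable {p : ℕ → ℝ}

lemma hasSum_centered (hp : IsCriticalOffspring p) :
    HasSum (fun k : ℕ => p k * ((k : ℝ) - 1)) 0 := by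
  have := hp.hasSum_mean.sub hp.hasSum_one
  rw [sub_self] at this
  exact this.congr_fun fun k => by ring

lemma zero_pos (hp : IsCriticalOffspring p) : 0 < p 0 := by
  refine (hp.nonneg 0).lt_of_ne fun h0 => ?_
  have hnn (k : ℕ) : 0 ≤ p k * ((k : ℝ) - 1) := by
    rcases Nat.eq_zero_or_pos k with rfl | hk
    · simp [← h0]
    · exact mul_nonneg (hp.nonneg k) (by have : (1 : ℝ) ≤ k := by exact_mod_cast hk
                                         linarith)
  have hz := (hasSum_zero_iff_of_nonneg hnn).1 hp.hasSum_centered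
  obtain ⟨k, hk1, hk⟩ := hp.exists_ne_one
  have := congrFun hz k
  simp only [Pi.zero_apply, mul_eq_zero, hk, false_or] at this
  exact hk1 (by exact_mod_cast sub_eq_zero.1 this)

lemma coeff_pow_nonneg (hp : IsCriticalOffspring p) (n j : ℕ) :
    0 ≤ coeff j (PowerSeries.mk p ^ n) := by
  induction n generalizing j with
  | zero => rw [pow_zero, coeff_one]; split_ifs <;> norm_num
  | succ n ih =>
    rw [pow_succ, coeff_mul]
    exact Finset.sum_nonneg fun x _ => mul_nonneg (ih _) (by simpa using hp.nonneg _)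

lemma summable_norm (hp : IsCriticalOffspring p) {z : ℂ} (hz : ‖z‖ ≤ 1) :
    Summable fun k => ‖(p k : ℂ) * z ^ k‖ := by
  refine hp.hasSum_one.summable.of_nonneg_of_le (fun _ => norm_nonneg _) fun k => ?_
  rw [norm_mul, norm_pow, Complex.norm_real, Real.norm_of_nonneg (hp.nonneg k)]
  exact mul_le_of_le_one_right (hp.nonneg k) (pow_le_one₀ (norm_nonneg _) hz)

lemma hasSum_coeff_pow (hp : IsCriticalOffspring p) {z : ℂ} (hz : ‖z‖ ≤ 1) (n : ℕ) :
    Summable (fun j => ‖((coeff j (PowerSeries.mk p ^ n) : ℝ) : ℂ) * z ^ j‖) ∧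
      HasSum (fun j => ((coeff j (PowerSeries.mk p ^ n) : ℝ) : ℂ) * z ^ j) (genFun p z ^ n) := by
  induction n with
  | zero =>
    have h (j : ℕ) (hj : j ≠ 0) : ((coeff j (PowerSeries.mk p ^ 0) : ℝ) : ℂ) * z ^ j = 0 := by
      simp [coeff_one, hj]
    refine ⟨summable_of_ne_finset_zero (s := {0}) fun j hj => ?_, ?_⟩
    · rw [h j (by simpa using hj), norm_zero]
    · convert! hasSum_single 0 h using 1
      simp
  | succ n ih =>
    have heq (j : ℕ) : ((coeff j (PowerSeries.mk p ^ (n + 1)) : ℝ) : ℂ) * z ^ j =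
        ∑ x ∈ Finset.HasAntidiagonal.antidiagonal j,
          ((coeff x.1 (PowerSeries.mk p ^ n) : ℝ) : ℂ) * z ^ x.1 * ((p x.2 : ℂ) * z ^ x.2) := by
      rw [pow_succ, coeff_mul]
      push_cast
      rw [Finset.sum_mul]
      refine Finset.sum_congr rfl fun x hx => ?_
      rw [← Finset.HasAntidiagonal.mem_antidiagonal.1 hx, pow_add, coeff_mk]
      ring
    simp_rw [heq]
    have hs := summable_norm_sum_mul_antidiagonal_of_summable_norm ih.1 (hp.summable_norm hz)
    refine ⟨hs, ?_⟩
    rw [pow_succ, ← ih.2.tsum_eq, genFun,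
      tsum_mul_tsum_eq_tsum_sum_antidiagonal_of_summable_norm ih.1 (hp.summable_norm hz)]
    exact hs.of_norm.hasSum

lemma genFun_one (hp : IsCriticalOffspring p) : genFun p 1 = 1 := by
  have := (Complex.hasSum_ofReal.2 hp.hasSum_one).tsum_eq
  simpa [genFun] using this

lemma hasSum_coeff_pow_one (hp : IsCriticalOffspring p) (n : ℕ) :
    HasSum (fun j => coeff j (PowerSeries.mk p ^ n)) 1 := by
  have := (hp.hasSum_coeff_pow (z := 1) (by simp) n).2
  rw [hp.genFun_one] at this
  simp only [one_pow, mul_one] at this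
  exact Complex.hasSum_ofReal.1 (by simpa using this)

lemma coeff_pow_le_one (hp : IsCriticalOffspring p) (n j : ℕ) :
    coeff j (PowerSeries.mk p ^ n) ≤ 1 :=
  le_hasSum (hp.hasSum_coeff_pow_one n) j fun i _ => hp.coeff_pow_nonneg n i

/-- The defect of the characteristic function, as a weighted sum of squares. -/
lemma norm_genFun_sq_le (hp : IsCriticalOffspring p) {z : ℂ} (hz : ‖z‖ = 1) :
    Summable (fun k => p k * ‖z ^ k - 1‖ ^ 2) ∧
      ‖genFun p z‖ ^ 2 ≤ 1 - p 0 * ∑' k, p k * ‖z ^ k - 1‖ ^ 2 := by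
  have hre (k : ℕ) : p k * ‖z ^ k - 1‖ ^ 2 = 2 * p k - 2 * ((p k : ℂ) * z ^ k).re := by
    have h1 : ‖z ^ k‖ = 1 := by simp [hz]
    rw [re_ofReal_mul, ← Complex.normSq_eq_norm_sq, Complex.normSq_sub, Complex.normSq_eq_norm_sq,
      h1]
    simp
    ring
  have hs : HasSum (fun k => (p k : ℂ) * z ^ k) (genFun p z) :=
    (hp.summable_norm hz.le).of_norm.hasSum
  have hD := (hp.hasSum_one.mul_left 2).sub ((Complex.hasSum_re hs).mul_left 2)
  simp_rw [← hre] at hD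
  refine ⟨hD.summable, ?_⟩
  rw [hD.tsum_eq]
  set ψ := genFun p z - p 0 with hψ
  have hs0 : HasSum (fun k => (p (k + 1) : ℂ) * z ^ (k + 1)) ψ := by
    have := (hasSum_nat_add_iff' 1).2 hs
    simpa using this
  have hs1 : HasSum (fun k => p (k + 1)) (1 - p 0) := by
    have := (hasSum_nat_add_iff' 1).2 hp.hasSum_one
    simpa using this
  have hnorm : ‖ψ‖ ≤ 1 - p 0 := by
    rw [← hs0.tsum_eq]
    refine tsum_of_norm_bounded hs1 fun k => ?_
    simp [hz, abs_of_nonneg (hp.nonneg (k + 1))]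
  have hφ : genFun p z = p 0 + ψ := by rw [hψ]; ring
  have hsq : ‖ψ‖ ^ 2 ≤ (1 - p 0) ^ 2 := by gcongr
  have key : ‖genFun p z‖ ^ 2 = p 0 ^ 2 + ‖ψ‖ ^ 2 + 2 * p 0 * ψ.re := by
    rw [hφ, ← Complex.normSq_eq_norm_sq, Complex.normSq_add, Complex.normSq_eq_norm_sq ψ,
      Complex.normSq_ofReal]
    simp
    ring
  have hr : (genFun p z).re = p 0 + ψ.re := by rw [hφ]; simp
  rw [key, hr]
  nlinarith

/-- The span `d` of the offspring distribution, with a Gaussian bound for the characteristic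
function on the fundamental interval of length `2π / d`. -/
lemma exists_span (hp : IsCriticalOffspring p) :
    ∃ d : ℕ, 0 < d ∧ (∀ k, p k ≠ 0 → d ∣ k) ∧ ∃ c : ℝ, 0 < c ∧ ∀ t : ℝ, |t| ≤ Real.pi / d →
      ‖genFun p (exp (t * I))‖ ≤ Real.exp (-c * t ^ 2) := by
  let D : ℝ → ℝ := fun t => ∑' k, p k * ‖exp (t * I) ^ k - 1‖ ^ 2
  have hD (t : ℝ) := hp.norm_genFun_sq_le (norm_exp_ofReal_mul_I t)
  have hD0 (t : ℝ) : 0 ≤ D t := tsum_nonneg fun k => mul_nonneg (hp.nonneg k) (sq_nonneg _)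
  let H : AddSubgroup ℤ :=
    { carrier := {m | ∃ K : ℝ, 0 ≤ K ∧ ∀ t : ℝ, ‖exp (t * I) ^ m - 1‖ ^ 2 ≤ K * D t}
      zero_mem' := ⟨0, le_rfl, fun t => by simp⟩
      add_mem' := by
        rintro a b ⟨K, hK, ha⟩ ⟨L, hL, hb⟩
        refine ⟨2 * K + 2 * L, by positivity, fun t => ?_⟩
        have hz : exp (t * I) ≠ 0 := exp_ne_zero _
        have hn : ‖exp (t * I) ^ a‖ = 1 := by simp [norm_exp_ofReal_mul_I]
        have h1 : ‖exp (t * I) ^ (a + b) - 1‖ ≤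
            ‖exp (t * I) ^ b - 1‖ + ‖exp (t * I) ^ a - 1‖ := by
          have : exp (t * I) ^ (a + b) - 1 =
              exp (t * I) ^ a * (exp (t * I) ^ b - 1) + (exp (t * I) ^ a - 1) := by
            rw [zpow_add₀ hz]; ring
          rw [this]
          refine (norm_add_le _ _).trans ?_
          rw [norm_mul, hn, one_mul]
        have h2 := pow_le_pow_left₀ (norm_nonneg _) h1 2
        nlinarith [ha t, hb t, sq_nonneg (‖exp (t * I) ^ b - 1‖ - ‖exp (t * I) ^ a - 1‖)]
      neg_mem' := by
        rintro a ⟨K, hK, ha⟩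
        refine ⟨K, hK, fun t => ?_⟩
        have hz : exp (t * I) ^ a ≠ 0 := zpow_ne_zero _ (exp_ne_zero _)
        have hn : ‖exp (t * I) ^ a‖ = 1 := by simp [norm_exp_ofReal_mul_I]
        have : exp (t * I) ^ (-a) - 1 = -((exp (t * I) ^ a)⁻¹ * (exp (t * I) ^ a - 1)) := by
          rw [zpow_neg, mul_sub, inv_mul_cancel₀ hz]; ring
        rw [this, norm_neg, norm_mul, norm_inv, hn, inv_one, one_mul]
        exact ha t }
  have hmem (k : ℕ) (hk : p k ≠ 0) : (k : ℤ) ∈ H := by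
    have hk' : 0 < p k := (hp.nonneg k).lt_of_ne' hk
    refine ⟨(p k)⁻¹, by positivity, fun t => ?_⟩
    rw [zpow_natCast, inv_mul_eq_div, le_div_iff₀ hk', mul_comm]
    exact (hD t).1.le_tsum k fun j _ => mul_nonneg (hp.nonneg j) (sq_nonneg _)
  obtain ⟨a, ha⟩ := Int.subgroup_cyclic H
  rw [← AddSubgroup.zmultiples_eq_closure] at ha
  have hdvd (k : ℕ) (hk : p k ≠ 0) : a.natAbs ∣ k := by
    have := hmem k hk
    rw [ha, Int.mem_zmultiples_iff] at this
    exact Int.natCast_dvd_natCast.1 (by simpa using this)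
  have ha0 : 0 < a.natAbs := by
    refine Nat.pos_of_ne_zero fun h => ?_
    have hz (k : ℕ) (hk : k ≠ 0) : p k = 0 := by
      by_contra hpk
      have := hdvd k hpk
      rw [h, zero_dvd_iff] at this
      exact hk this
    have h1 : HasSum (fun k : ℕ => (k : ℝ) * p k) 0 := by
      convert! (hasSum_zero : HasSum (fun _ : ℕ => (0 : ℝ)) 0) using 2 with k
      rcases eq_or_ne k 0 with rfl | hk
      · simp
      · simp [hz k hk]
    exact one_ne_zero (hp.hasSum_mean.unique h1)
  have hdmem : (a.natAbs : ℤ) ∈ H := by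
    rw [ha, Int.mem_zmultiples_iff]
    exact Int.dvd_natAbs.2 dvd_rfl
  obtain ⟨K, hK, hbound⟩ := hdmem
  refine ⟨a.natAbs, ha0, hdvd, ?_⟩
  set d := a.natAbs
  have hd : (0 : ℝ) < d := by exact_mod_cast ha0
  have hp0 := hp.zero_pos
  refine ⟨p 0 * (2 / Real.pi * d) ^ 2 / (2 * (K + 1)), by have := Real.pi_pos; positivity, ?_⟩
  intro t ht
  have hlow : (2 / Real.pi * d * |t|) ^ 2 ≤ (K + 1) * D t := by
    have h1 : ‖exp (t * I) ^ (d : ℤ) - 1‖ = 2 * |Real.sin (d * t / 2)| := by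
      rw [zpow_natCast, ← exp_nat_mul]
      have : (d : ℂ) * (t * I) = I * ((d * t : ℝ) : ℂ) := by push_cast; ring
      rw [this, norm_exp_I_mul_ofReal_sub_one]
      simp
    have h2 : |d * t / 2| ≤ Real.pi / 2 := by
      rw [abs_div, abs_mul, Nat.abs_cast, abs_two]
      have := (le_div_iff₀ hd).1 ht
      gcongr
      linarith
    have h3 := Real.mul_abs_le_abs_sin h2
    have h4 : 2 / Real.pi * d * |t| ≤ ‖exp (t * I) ^ (d : ℤ) - 1‖ := by
      rw [h1]
      rw [abs_div, abs_mul, Nat.abs_cast, abs_two] at h3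
      linarith
    have h5 := hbound t
    have h6 : (2 / Real.pi * d * |t|) ^ 2 ≤ ‖exp (t * I) ^ (d : ℤ) - 1‖ ^ 2 := by
      have := Real.pi_pos
      gcongr
    linarith [hD0 t]
  rw [mul_pow, sq_abs] at hlow
  have hsq := (hD t).2
  refine le_of_sq_le_sq (α := ℝ) ?_ (Real.exp_pos _).le
  calc ‖genFun p (exp (t * I))‖ ^ 2 ≤ 1 - p 0 * D t := hsq
    _ ≤ Real.exp (-(p 0 * D t)) := by
        have := Real.add_one_le_exp (-(p 0 * D t)); linarith
    _ ≤ Real.exp (2 * (-(p 0 * (2 / Real.pi * d) ^ 2 / (2 * (K + 1))) * t ^ 2)) := by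
        refine Real.exp_le_exp.2 ?_
        have : p 0 * ((2 / Real.pi * d) ^ 2 * t ^ 2) ≤ p 0 * ((K + 1) * D t) := by gcongr
        have h7 : p 0 * ((2 / Real.pi * d) ^ 2 * t ^ 2) / (K + 1) ≤ p 0 * D t := by
          rw [div_le_iff₀ (by positivity)]; linarith
        have h8 : 2 * (-(p 0 * (2 / Real.pi * d) ^ 2 / (2 * (K + 1))) * t ^ 2) =
            -(p 0 * ((2 / Real.pi * d) ^ 2 * t ^ 2) / (K + 1)) := by
          field_simp
        rw [h8]
        linarith
    _ = _ := by rw [← Real.exp_nat_mul]; norm_num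

end IsCriticalOffspring

namespace IsCriticalOffspring

open PowerSeries Complex MeasureTheory Topology

variable {p : ℕ → ℝ}

lemma dvd_of_coeff_pow_ne_zero {d : ℕ} (hd : ∀ k, p k ≠ 0 → d ∣ k) {n j : ℕ}
    (h : coeff j (PowerSeries.mk p ^ n) ≠ 0) : d ∣ j := by
  induction n generalizing j with
  | zero =>
    rw [pow_zero, coeff_one] at h
    have : j = 0 := by by_contra hj; simp [hj] at h
    simp [this]
  | succ n ih =>
    rw [pow_succ, coeff_mul] at h
    obtain ⟨x, hx, hne⟩ := Finset.exists_ne_zero_of_sum_ne_zero h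
    rw [← Finset.HasAntidiagonal.mem_antidiagonal.1 hx]
    exact dvd_add (ih (left_ne_zero_of_mul hne)) (hd _ (by simpa using right_ne_zero_of_mul hne))

lemma integral_exp_span {d : ℕ} (hd : 0 < d) (q : ℤ) (hq : q ≠ 0) :
    ∫ t in (-(Real.pi / d))..(Real.pi / d), exp (((d * q : ℝ) : ℂ) * I * t) = 0 := by
  have hd' : (d : ℂ) ≠ 0 := by exact_mod_cast hd.ne'
  have hq' : (q : ℂ) ≠ 0 := by exact_mod_cast hq
  rw [integral_exp_mul_complex (by simp [hd', hq']), div_eq_zero_iff]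
  left
  rw [sub_eq_zero, exp_eq_exp_iff_exists_int]
  refine ⟨q, ?_⟩
  push_cast
  field_simp
  ring

lemma continuous_genFun_exp (hp : IsCriticalOffspring p) :
    Continuous fun t : ℝ => genFun p (exp (t * I)) := by
  unfold genFun
  refine continuous_tsum (fun k => by fun_prop) hp.hasSum_one.summable fun k t => ?_
  simp [norm_exp_ofReal_mul_I, abs_of_nonneg (hp.nonneg k)]

/-- Fourier inversion on the fundamental interval of a lattice distribution. -/
lemma coeff_pow_eq_integral (hp : IsCriticalOffspring p) {d : ℕ} (hd0 : 0 < d)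
    (hd : ∀ k, p k ≠ 0 → d ∣ k) (n j : ℕ) (hj : d ∣ j) :
    ((coeff j (PowerSeries.mk p ^ n) : ℝ) : ℂ) * (2 * Real.pi / d) =
      ∫ t in (-(Real.pi / d))..(Real.pi / d),
        genFun p (exp (t * I)) ^ n * exp (-(j * (t * I))) := by
  have hsum : HasSum (fun i => ∫ t in (-(Real.pi / d))..(Real.pi / d),
      ((coeff i (PowerSeries.mk p ^ n) : ℝ) : ℂ) * exp (t * I) ^ i * exp (-(j * (t * I))))
      (∫ t in (-(Real.pi / d))..(Real.pi / d),
        genFun p (exp (t * I)) ^ n * exp (-(j * (t * I)))) := by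
    refine intervalIntegral.hasSum_integral_of_dominated_convergence
      (fun i _ => coeff i (PowerSeries.mk p ^ n)) (fun i => ?_) (fun i => ?_) ?_ ?_ ?_
    · exact Continuous.aestronglyMeasurable (by fun_prop)
    · refine Eventually.of_forall fun t _ => ?_
      have : ‖exp (-(j * (t * I)))‖ = 1 := by
        rw [show -(j * (t * I)) = ((-(j * t) : ℝ) : ℂ) * I by push_cast; ring,
          norm_exp_ofReal_mul_I]
      rw [norm_mul, this, norm_mul, norm_pow, norm_exp_ofReal_mul_I, Complex.norm_real,
        Real.norm_of_nonneg (hp.coeff_pow_nonneg n i)]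
      simp
    · exact Eventually.of_forall fun t _ => (hp.hasSum_coeff_pow_one n).summable
    · exact intervalIntegrable_const
    · refine Eventually.of_forall fun t _ => ?_
      exact ((hp.hasSum_coeff_pow (norm_exp_ofReal_mul_I t).le n).2).mul_right _
  rw [← hsum.tsum_eq, tsum_eq_single j]
  · have (t : ℝ) : ((coeff j (PowerSeries.mk p ^ n) : ℝ) : ℂ) * exp (t * I) ^ j *
        exp (-(j * (t * I))) = ((coeff j (PowerSeries.mk p ^ n) : ℝ) : ℂ) := by
      rw [← exp_nat_mul, mul_assoc, ← exp_add]
      simp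
    simp_rw [this]
    rw [intervalIntegral.integral_const, real_smul]
    push_cast
    ring
  · intro i hij
    by_cases hi : coeff i (PowerSeries.mk p ^ n) = 0
    · simp [hi]
    obtain ⟨a, rfl⟩ := dvd_of_coeff_pow_ne_zero hd hi
    obtain ⟨b, rfl⟩ := hj
    have hab : (a : ℤ) - b ≠ 0 := by
      intro h
      apply hij
      rw [show a = b by omega]
    have (t : ℝ) : ((coeff (d * a) (PowerSeries.mk p ^ n) : ℝ) : ℂ) * exp (t * I) ^ (d * a) *
        exp (-((d * b : ℕ) * (t * I))) = ((coeff (d * a) (PowerSeries.mk p ^ n) : ℝ) : ℂ) *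
          exp (((d * ((a : ℤ) - b : ℤ) : ℝ) : ℂ) * I * t) := by
      rw [← exp_nat_mul, mul_assoc, ← exp_add]
      congr 2
      push_cast
      ring
    simp_rw [this]
    rw [intervalIntegral.integral_const_mul, integral_exp_span hd0 _ hab, mul_zero]

/-- Uniform bound for the point probabilities of a sum of independent offspring numbers. -/
lemma exists_coeff_pow_le (hp : IsCriticalOffspring p) :
    ∃ C : ℝ, 0 < C ∧ ∀ n j : ℕ, coeff j (PowerSeries.mk p ^ n) ≤ C / √(n + 1) := by
  obtain ⟨d, hd0, hd, c, hc, hbound⟩ := hp.exists_span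
  have hdR : (0 : ℝ) < d := by exact_mod_cast hd0
  have hpi := Real.pi_pos
  have h2 (n : ℕ) (hn : 0 < n) : √((n : ℝ) + 1) ≤ √2 * √n := by
    rw [← Real.sqrt_mul (by norm_num)]
    refine Real.sqrt_le_sqrt ?_
    have : (1 : ℝ) ≤ n := by exact_mod_cast hn
    linarith
  refine ⟨d / (2 * Real.pi) * √(Real.pi / c) * √2 + 1, by positivity, fun n j => ?_⟩
  rw [le_div_iff₀ (by positivity)]
  by_cases hj : d ∣ j
  swap
  · have : coeff j (PowerSeries.mk p ^ n) = 0 := by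
      by_contra h
      exact hj (dvd_of_coeff_pow_ne_zero hd h)
    rw [this, zero_mul]
    positivity
  rcases Nat.eq_zero_or_pos n with rfl | hn
  · have := hp.coeff_pow_le_one 0 j
    simp only [Nat.cast_zero, zero_add, Real.sqrt_one, mul_one]
    have : 0 ≤ d / (2 * Real.pi) * √(Real.pi / c) * √2 := by positivity
    linarith
  have hnR : (0 : ℝ) < n := by exact_mod_cast hn
  have hle : (-(Real.pi / d)) ≤ Real.pi / d := by
    have : 0 ≤ Real.pi / d := by positivity
    linarith
  have hI := congrArg norm (hp.coeff_pow_eq_integral hd0 hd n j hj)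
  have hnorm : ‖((coeff j (PowerSeries.mk p ^ n) : ℝ) : ℂ) * (2 * Real.pi / d)‖ =
      coeff j (PowerSeries.mk p ^ n) * (2 * Real.pi / d) := by
    rw [norm_mul, Complex.norm_real, Real.norm_of_nonneg (hp.coeff_pow_nonneg n j)]
    simp [abs_of_pos hpi]
  have hnorm_int : ‖∫ t in (-(Real.pi / d))..(Real.pi / d),
      genFun p (exp (t * I)) ^ n * exp (-(j * (t * I)))‖ ≤ √(Real.pi / (c * n)) := by
    calc _ ≤ ∫ t in (-(Real.pi / d))..(Real.pi / d), Real.exp (-(c * n) * t ^ 2) := by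
          refine intervalIntegral.norm_integral_le_of_norm_le hle ?_ ?_
          · refine Eventually.of_forall fun t ht => ?_
            have h1 : ‖exp (-(j * (t * I)))‖ = 1 := by
              rw [show -(j * (t * I)) = ((-(j * t) : ℝ) : ℂ) * I by push_cast; ring,
                norm_exp_ofReal_mul_I]
            rw [norm_mul, h1, mul_one, norm_pow]
            refine (pow_le_pow_left₀ (norm_nonneg _)
              (hbound t (abs_le.2 ⟨ht.1.le, ht.2⟩)) n).trans_eq ?_
            rw [← Real.exp_nat_mul]
            ring_nf
          · exact Continuous.intervalIntegrable (by fun_prop) _ _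
      _ ≤ ∫ t : ℝ, Real.exp (-(c * n) * t ^ 2) := by
          rw [intervalIntegral.integral_of_le hle]
          exact setIntegral_le_integral (integrable_exp_neg_mul_sq (by positivity))
            (Eventually.of_forall fun t => (Real.exp_pos _).le)
      _ = _ := integral_gaussian _
  rw [hnorm] at hI
  rw [← hI, show Real.pi / (c * n) = Real.pi / c / n by rw [div_div],
    Real.sqrt_div (by positivity)] at hnorm_int
  have hc1 : coeff j (PowerSeries.mk p ^ n) ≤ d / (2 * Real.pi) * (√(Real.pi / c) / √n) := by
    rw [div_mul_eq_mul_div, le_div_iff₀ (by positivity)]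
    have := mul_le_mul_of_nonneg_left hnorm_int hdR.le
    calc coeff j (PowerSeries.mk p ^ n) * (2 * Real.pi)
        = d * (coeff j (PowerSeries.mk p ^ n) * (2 * Real.pi / d)) := by field_simp
      _ ≤ _ := this
  calc coeff j (PowerSeries.mk p ^ n) * √((n : ℝ) + 1)
      ≤ d / (2 * Real.pi) * (√(Real.pi / c) / √n) * (√2 * √n) := by
        gcongr
        exact h2 n hn
    _ = d / (2 * Real.pi) * √(Real.pi / c) * √2 := by
        field_simp
    _ ≤ _ := by linarith

end IsCriticalOffspring

namespace IsCriticalOffspring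

open PowerSeries Complex MeasureTheory Topology

variable {p : ℕ → ℝ}

lemma norm_exp_sub_one_sub_le (x : ℝ) : ‖exp (x * I) - 1 - x * I‖ ≤ 2 * x ^ 2 := by
  have hx : ‖(x : ℂ) * I‖ = |x| := by simp
  rcases le_or_gt |x| 1 with h | h
  · have := Complex.norm_exp_sub_one_sub_id_le (x := x * I) (by rw [hx]; exact h)
    rw [hx, sq_abs] at this
    nlinarith [sq_nonneg x]
  · have h1 : ‖exp (x * I) - 1‖ ≤ |x| := by
      rw [mul_comm]; exact Real.norm_exp_I_mul_ofReal_sub_one_le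
    calc _ ≤ ‖exp (x * I) - 1‖ + ‖(x : ℂ) * I‖ := norm_sub_le _ _
      _ ≤ 2 * |x| := by rw [hx]; linarith
      _ ≤ 2 * |x| ^ 2 := by nlinarith
      _ = _ := by rw [sq_abs]

lemma tendsto_mul_exp_sub_one_sub (x : ℝ) :
    Tendsto (fun n : ℕ => (n : ℂ) * (exp ((x / √n : ℝ) * I) - 1 - (x / √n : ℝ) * I)) atTop
      (𝓝 (-(x ^ 2 / 2 : ℝ))) := by
  rw [tendsto_iff_norm_sub_tendsto_zero]
  have hlim : Tendsto (fun n : ℕ => |x| ^ 3 * Real.exp |x| / √n) atTop (𝓝 0) :=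
    (Real.tendsto_sqrt_atTop.comp tendsto_natCast_atTop_atTop).const_div_atTop _
  refine squeeze_zero' (Eventually.of_forall fun n => norm_nonneg _) ?_ hlim
  filter_upwards [eventually_gt_atTop 0] with n hn
  have hnR : (0 : ℝ) < n := by exact_mod_cast hn
  have hs : (0 : ℝ) < √n := by positivity
  have hs1 : 1 ≤ √(n : ℝ) := by rw [Real.one_le_sqrt]; exact_mod_cast hn
  have hsq : √(n : ℝ) ^ 2 = n := Real.sq_sqrt hnR.le
  set y : ℝ := x / √n with hy
  have hny : (n : ℂ) * ((y : ℂ) * I) ^ 2 / 2 = -(x ^ 2 / 2 : ℝ) := by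
    have : (n : ℝ) * y ^ 2 = x ^ 2 := by rw [hy, div_pow, hsq]; field_simp
    rw [mul_pow, I_sq, ← this]
    push_cast
    ring
  have hb := Complex.norm_exp_sub_sum_le_norm_mul_exp ((y : ℂ) * I) 3
  have hyx : |y| ≤ |x| := by
    rw [hy, abs_div, abs_of_pos hs]
    exact div_le_self (abs_nonneg _) hs1
  have hsum : ∑ m ∈ Finset.range 3, ((y : ℂ) * I) ^ m / (m.factorial : ℂ) =
      1 + (y : ℂ) * I + ((y : ℂ) * I) ^ 2 / 2 := by
    simp [Finset.sum_range_succ]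
  have hyn : ‖(y : ℂ) * I‖ = |y| := by simp
  rw [hsum, hyn] at hb
  rw [← hny]
  calc ‖(n : ℂ) * (exp (y * I) - 1 - y * I) - n * ((y : ℂ) * I) ^ 2 / 2‖
      = n * ‖exp (y * I) - (1 + (y : ℂ) * I + ((y : ℂ) * I) ^ 2 / 2)‖ := by
        rw [← Complex.norm_natCast n, ← norm_mul]
        congr 1
        ring
    _ ≤ n * (|y| ^ 3 * Real.exp |x|) := by
        gcongr
        exact hb.trans (by gcongr)
    _ = |x| ^ 3 * Real.exp |x| / √n := by
        rw [hy, abs_div, abs_of_pos hs, div_pow]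
        field_simp
        rw [hsq, mul_comm]

lemma hasSum_genFun_centered (hp : IsCriticalOffspring p) (t : ℝ) :
    HasSum (fun k : ℕ => (p k : ℂ) * (exp ((((k : ℝ) - 1) * t : ℝ) * I) - 1 -
      (((k : ℝ) - 1) * t : ℝ) * I)) (genFun p (exp (t * I)) * exp (-(t * I)) - 1) := by
  have h1 : HasSum (fun k => (p k : ℂ) * exp (t * I) ^ k) (genFun p (exp (t * I))) :=
    (hp.summable_norm (norm_exp_ofReal_mul_I t).le).of_norm.hasSum
  have h2 := Complex.hasSum_ofReal.2 hp.hasSum_one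
  have h3 := (Complex.hasSum_ofReal.2 hp.hasSum_centered).mul_right ((t : ℂ) * I)
  have := ((h1.mul_right (exp (-(t * I)))).sub h2).sub h3
  simp only [ofReal_zero, zero_mul, sub_zero, ofReal_one] at this
  refine this.congr_fun fun k => ?_
  rw [← exp_nat_mul, mul_assoc, ← exp_add]
  push_cast
  rw [show (k : ℂ) * (t * I) + -(t * I) = ((k : ℂ) - 1) * t * I by ring]
  ring

lemma tendsto_genFun_pow (hp : IsCriticalOffspring p) (u : ℝ) :
    Tendsto (fun n : ℕ => (genFun p (exp ((u / √n : ℝ) * I)) * exp (-((u / √n : ℝ) * I))) ^ n)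
      atTop (𝓝 (Real.exp (-((∑' k : ℕ, p k * ((k : ℝ) - 1) ^ 2) / 2) * u ^ 2) : ℝ)) := by
  have hlim : Tendsto (fun n : ℕ => (n : ℂ) *
      (genFun p (exp ((u / √n : ℝ) * I)) * exp (-((u / √n : ℝ) * I)) - 1)) atTop
      (𝓝 (∑' k : ℕ, (p k : ℂ) * (-((((k : ℝ) - 1) * u) ^ 2 / 2 : ℝ)))) := by
    have heq (n : ℕ) : (n : ℂ) *
        (genFun p (exp ((u / √n : ℝ) * I)) * exp (-((u / √n : ℝ) * I)) - 1) =
        ∑' k : ℕ, (p k : ℂ) * (n * (exp (((((k : ℝ) - 1) * u) / √n : ℝ) * I) - 1 -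
          ((((k : ℝ) - 1) * u) / √n : ℝ) * I)) := by
      rw [← (hp.hasSum_genFun_centered (u / √n)).tsum_eq, ← tsum_mul_left]
      refine tsum_congr fun k => ?_
      rw [mul_div_assoc]
      ring
    simp_rw [heq]
    refine tendsto_tsum_of_dominated_convergence
      (bound := fun k : ℕ => 2 * u ^ 2 * (p k * ((k : ℝ) - 1) ^ 2)) (hp.summable_sq.mul_left _)
      (fun k => (tendsto_mul_exp_sub_one_sub _).const_mul _) ?_
    filter_upwards [eventually_gt_atTop 0] with n hn k
    have hnR : (0 : ℝ) < n := by exact_mod_cast hn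
    rw [norm_mul, norm_mul, Complex.norm_real, Real.norm_of_nonneg (hp.nonneg k),
      Complex.norm_natCast]
    have hpk := hp.nonneg k
    calc p k * (n * ‖exp (((((k : ℝ) - 1) * u) / √n : ℝ) * I) - 1 -
          ((((k : ℝ) - 1) * u) / √n : ℝ) * I‖)
        ≤ p k * (n * (2 * ((((k : ℝ) - 1) * u) / √n) ^ 2)) := by
          gcongr
          exact norm_exp_sub_one_sub_le _
      _ = _ := by
          rw [div_pow, Real.sq_sqrt hnR.le]
          field_simp
  have h := Complex.tendsto_one_add_pow_exp_of_tendsto hlim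
  simp only [add_sub_cancel] at h
  convert! h using 2
  rw [ofReal_exp]
  congr 1
  have (k : ℕ) : (p k : ℂ) * (-((((k : ℝ) - 1) * u) ^ 2 / 2 : ℝ)) =
      ((p k * ((k : ℝ) - 1) ^ 2 * (-(u ^ 2 / 2)) : ℝ) : ℂ) := by
    push_cast
    ring
  simp_rw [this]
  rw [← Complex.ofReal_tsum, tsum_mul_right]
  push_cast
  ring

lemma variance_pos (hp : IsCriticalOffspring p) : 0 < ∑' k : ℕ, p k * ((k : ℝ) - 1) ^ 2 := by
  have h := hp.summable_sq.le_tsum 0 fun k _ => mul_nonneg (hp.nonneg k) (sq_nonneg _)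
  have := hp.zero_pos
  simp only [Nat.cast_zero, zero_sub, even_two, Even.neg_pow, one_pow, mul_one] at h
  linarith

/-- Lower bound in the local limit theorem for sums of independent offspring numbers, at the
mean minus one. -/
lemma eventually_le_coeff_pow (hp : IsCriticalOffspring p) :
    ∃ c : ℝ, 0 < c ∧ ∀ᶠ n : ℕ in atTop, coeff (n - 1) (PowerSeries.mk p ^ n) ≠ 0 →
      c / √n ≤ coeff (n - 1) (PowerSeries.mk p ^ n) := by
  obtain ⟨d, hd0, hd, c, hc, hbound⟩ := hp.exists_span
  have hdR : (0 : ℝ) < d := by exact_mod_cast hd0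
  have hpi := Real.pi_pos
  set v := (∑' k : ℕ, p k * ((k : ℝ) - 1) ^ 2) / 2 with hv
  have hv0 : 0 < v := half_pos hp.variance_pos
  let g : ℕ → ℝ → ℂ := fun n t => (genFun p (exp (t * I)) * exp (-(t * I))) ^ n * exp (t * I)
  have hgcont (n : ℕ) : Continuous (g n) := by
    have := hp.continuous_genFun_exp
    fun_prop
  let A : ℕ → Set ℝ := fun n => Ioc (-(Real.pi / d * √n)) (Real.pi / d * √n)
  have hlim : Tendsto (fun n : ℕ => ∫ u : ℝ, (A n).indicator (fun u => g n (u / √n)) u) atTop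
      (𝓝 (∫ u : ℝ, ((Real.exp (-v * u ^ 2) : ℝ) : ℂ))) := by
    refine tendsto_integral_filter_of_dominated_convergence (fun u => Real.exp (-c * u ^ 2))
      (Eventually.of_forall fun n => ?_) ?_ (integrable_exp_neg_mul_sq hc)
      (Eventually.of_forall fun u => ?_)
    · refine AEStronglyMeasurable.indicator ?_ measurableSet_Ioc
      exact ((hgcont n).comp (by fun_prop)).aestronglyMeasurable
    · filter_upwards [eventually_gt_atTop 0] with n hn
      refine Eventually.of_forall fun u => ?_
      have hnR : (0 : ℝ) < n := by exact_mod_cast hn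
      have hs : (0 : ℝ) < √n := by positivity
      by_cases hu : u ∈ A n
      · rw [indicator_of_mem hu]
        have hun : |u / √n| ≤ Real.pi / d := by
          rw [abs_div, abs_of_pos hs, div_le_iff₀ hs]
          exact abs_le.2 ⟨hu.1.le, hu.2⟩
        have h1 : ‖exp (-((u / √n : ℝ) * I))‖ = 1 := by
          rw [← neg_mul, ← ofReal_neg, norm_exp_ofReal_mul_I]
        simp only [g]
        rw [norm_mul, norm_pow, norm_mul, h1, norm_exp_ofReal_mul_I, mul_one, mul_one]
        refine (pow_le_pow_left₀ (norm_nonneg _) (hbound _ hun) n).trans_eq ?_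
        rw [← Real.exp_nat_mul, div_pow, Real.sq_sqrt hnR.le]
        congr 1
        field_simp
      · rw [indicator_of_notMem hu, norm_zero]
        exact (Real.exp_pos _).le
    · have hto : Tendsto (fun n : ℕ => Real.pi / d * √n) atTop atTop :=
        (Real.tendsto_sqrt_atTop.comp tendsto_natCast_atTop_atTop).const_mul_atTop (by positivity)
      have hmem : ∀ᶠ n : ℕ in atTop, u ∈ A n := by
        filter_upwards [hto.eventually_gt_atTop |u|] with n hn
        have := abs_lt.1 hn
        exact ⟨this.1, this.2.le⟩
      have h0 : Tendsto (fun n : ℕ => exp ((u / √n : ℝ) * I)) atTop (𝓝 1) := by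
        have h1 : Tendsto (fun n : ℕ => u / √n) atTop (𝓝 0) :=
          (Real.tendsto_sqrt_atTop.comp tendsto_natCast_atTop_atTop).const_div_atTop _
        have h2 : Continuous fun s : ℝ => exp (s * I) := by fun_prop
        have := (h2.tendsto 0).comp h1
        simpa [Function.comp_def] using this
      have := (hp.tendsto_genFun_pow u).mul h0
      rw [mul_one] at this
      refine this.congr' ?_
      filter_upwards [hmem] with n hn
      rw [indicator_of_mem hn]
  have hnorm_int : ‖∫ u : ℝ, ((Real.exp (-v * u ^ 2) : ℝ) : ℂ)‖ = √(Real.pi / v) := by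
    rw [integral_complex_ofReal, integral_gaussian, Complex.norm_real,
      Real.norm_of_nonneg (Real.sqrt_nonneg _)]
  have hL : 0 < √(Real.pi / v) := by positivity
  have hev := hlim.norm.eventually_const_le (u := √(Real.pi / v) / 2) (by rw [hnorm_int]; linarith)
  refine ⟨√(Real.pi / v) / 2 * (d / (2 * Real.pi)), by positivity, ?_⟩
  filter_upwards [hev, eventually_gt_atTop 0] with n hn hn0 hne
  have hnR : (0 : ℝ) < n := by exact_mod_cast hn0
  have hs : (0 : ℝ) < √n := by positivity
  have hI := hp.coeff_pow_eq_integral hd0 hd n (n - 1) (dvd_of_coeff_pow_ne_zero hd hne)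
  have hg (t : ℝ) : genFun p (exp (t * I)) ^ n * exp (-((n - 1 : ℕ) * (t * I))) = g n t := by
    simp only [g]
    rw [mul_pow, mul_assoc, ← exp_nat_mul, ← exp_add, Nat.cast_sub hn0]
    congr 2
    push_cast
    ring
  simp_rw [hg] at hI
  have hle : -(Real.pi / d * √n) ≤ Real.pi / d * √n := by
    have : 0 ≤ Real.pi / d * √n := by positivity
    linarith
  have hscale : ∫ u : ℝ, (A n).indicator (fun u => g n (u / √n)) u =
      (√n : ℂ) * ∫ t in (-(Real.pi / d))..(Real.pi / d), g n t := by
    rw [integral_indicator measurableSet_Ioc, ← intervalIntegral.integral_of_le hle,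
      intervalIntegral.integral_comp_div _ hs.ne', real_smul]
    congr 2
    · field_simp
    · field_simp
  rw [hscale, ← hI, norm_mul, norm_mul, Complex.norm_real, Complex.norm_real,
    Real.norm_of_nonneg (hp.coeff_pow_nonneg n _), Real.norm_of_nonneg hs.le] at hn
  have h2 : ‖(2 * Real.pi / d : ℂ)‖ = 2 * Real.pi / d := by simp [abs_of_pos hpi]
  rw [h2] at hn
  rw [div_le_iff₀ hs]
  calc _ ≤ √n * (coeff (n - 1) (PowerSeries.mk p ^ n) * (2 * Real.pi / d)) *
        (d / (2 * Real.pi)) := by gcongr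
    _ = _ := by field_simp

end IsCriticalOffspring

lemma Real.exp_neg_le_one_sub_add_sq {y : ℝ} (hy : -1 ≤ y) : Real.exp (-y) ≤ 1 - y + y ^ 2 := by
  rcases le_or_gt y 1 with h | h
  · have := Real.norm_exp_sub_one_sub_id_le (x := -y) (by
      rw [norm_neg, Real.norm_eq_abs]; exact abs_le.2 ⟨hy, h⟩)
    rw [norm_neg, Real.norm_eq_abs, Real.norm_eq_abs, sq_abs] at this
    linarith [(abs_le.1 this).2]
  · have : Real.exp (-y) ≤ 1 := Real.exp_le_one_iff.2 (by linarith)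
    nlinarith

lemma sum_antidiagonal_mul_le {α β : ℕ → ℝ} {S B : ℝ} (hα : ∀ i, 0 ≤ α i) (hB : 0 ≤ B)
    (hβ : ∀ i, β i ≤ B) (hs : Summable α) (hS : ∑' i, α i ≤ S) (j : ℕ) :
    ∑ x ∈ Finset.HasAntidiagonal.antidiagonal j, α x.1 * β x.2 ≤ S * B := by
  calc ∑ x ∈ Finset.HasAntidiagonal.antidiagonal j, α x.1 * β x.2
      ≤ ∑ x ∈ Finset.HasAntidiagonal.antidiagonal j, α x.1 * B :=
        Finset.sum_le_sum fun x _ => mul_le_mul_of_nonneg_left (hβ _) (hα _)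
    _ = (∑ i ∈ Finset.range j.succ, α i) * B := by
        rw [Finset.Nat.sum_antidiagonal_eq_sum_range_succ (fun a _ => α a * B), Finset.sum_mul]
    _ ≤ S * B := by
        gcongr
        exact (hs.sum_le_tsum _ fun i _ => hα i).trans hS

namespace IsCriticalOffspring

open PowerSeries

variable {p : ℕ → ℝ}

lemma hasSum_coeff_pow_real (hp : IsCriticalOffspring p) {x : ℝ} (hx0 : 0 ≤ x) (hx : x ≤ 1)
    (n : ℕ) :
    HasSum (fun j => coeff j (PowerSeries.mk p ^ n) * x ^ j) ((∑' k, p k * x ^ k) ^ n) := by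
  have h := (hp.hasSum_coeff_pow (z := (x : ℂ))
    (by rw [Complex.norm_real, Real.norm_of_nonneg hx0]; exact hx) n).2
  have hG : genFun p x = ((∑' k, p k * x ^ k : ℝ) : ℂ) := by
    rw [Complex.ofReal_tsum]
    simp [genFun]
  rw [hG] at h
  refine Complex.hasSum_ofReal.1 ?_
  push_cast at h ⊢
  exact h

/-- Exponential moment bound for the lower deviations of a sum of offspring numbers. -/
lemma tsum_coeff_pow_mul_exp_le (hp : IsCriticalOffspring p) {l : ℝ} (hl0 : 0 ≤ l) (hl : l ≤ 1)
    (n : ℕ) :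
    Summable (fun j : ℕ => coeff j (PowerSeries.mk p ^ n) * Real.exp (l * ((n : ℝ) - j))) ∧
      ∑' j : ℕ, coeff j (PowerSeries.mk p ^ n) * Real.exp (l * ((n : ℝ) - j)) ≤
        Real.exp (n * (l ^ 2 * ∑' k : ℕ, p k * ((k : ℝ) - 1) ^ 2)) := by
  set v := ∑' k : ℕ, p k * ((k : ℝ) - 1) ^ 2 with hv
  have hx1 : Real.exp (-l) ≤ 1 := Real.exp_le_one_iff.2 (by linarith)
  have hx (n : ℕ) := (hp.hasSum_coeff_pow_real (Real.exp_pos (-l)).le hx1 n).mul_left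
    (Real.exp (n * l))
  have heq (n j : ℕ) : Real.exp (n * l) * (coeff j (PowerSeries.mk p ^ n) * Real.exp (-l) ^ j) =
      coeff j (PowerSeries.mk p ^ n) * Real.exp (l * ((n : ℝ) - j)) := by
    rw [← Real.exp_nat_mul, mul_left_comm, ← Real.exp_add]
    ring_nf
  simp_rw [heq] at hx
  have h1 := hx 1
  simp only [pow_one, coeff_mk, Nat.cast_one, one_mul] at h1
  refine ⟨(hx n).summable, ?_⟩
  rw [(hx n).tsum_eq, Real.exp_nat_mul, Real.exp_nat_mul, ← mul_pow]
  have hG : Real.exp l * ∑' k, p k * Real.exp (-l) ^ k ≤ Real.exp (l ^ 2 * v) := by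
    have h2 := (hp.hasSum_one.sub (hp.hasSum_centered.mul_left l)).add
      (hp.summable_sq.hasSum.mul_left (l ^ 2))
    rw [mul_zero, sub_zero, ← hv] at h2
    refine (hasSum_le (fun k => ?_) h1 h2).trans ?_
    · have hy : -1 ≤ l * ((k : ℝ) - 1) := by
        have : (0 : ℝ) ≤ k := k.cast_nonneg
        nlinarith
      have := mul_le_mul_of_nonneg_left (Real.exp_neg_le_one_sub_add_sq hy) (hp.nonneg k)
      rw [show l * (1 - (k : ℝ)) = -(l * ((k : ℝ) - 1)) by ring]
      linarith
    · have := Real.add_one_le_exp (l ^ 2 * v)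
      linarith
  refine pow_le_pow_left₀ (mul_nonneg (Real.exp_pos _).le (tsum_nonneg fun k => ?_)) hG n
  exact mul_nonneg (hp.nonneg k) (by positivity)

/-- A local limit upper bound with exponential decay for lower deviations. -/
lemma exists_exp_mul_coeff_pow_le (hp : IsCriticalOffspring p) :
    ∃ C : ℝ, 0 < C ∧ ∀ m j : ℕ, 0 < m + j →
      Real.exp (m / √(m + j : ℕ) / 2) * coeff j (PowerSeries.mk p ^ (m + j)) ≤
        C / √(m + j : ℕ) := by
  obtain ⟨C, hC, hbound⟩ := hp.exists_coeff_pow_le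
  set v := ∑' k : ℕ, p k * ((k : ℝ) - 1) ^ 2 with hv
  have hv0 : 0 ≤ v := hp.variance_pos.le
  refine ⟨2 * (Real.exp v * (C * √2)), by positivity, fun m j hmj => ?_⟩
  obtain ⟨a, b, hab, ha, hb⟩ : ∃ a b, m + j = a + b ∧ m + j ≤ 2 * (a + 1) ∧
      m + j ≤ 2 * (b + 1) := ⟨(m + j) / 2, m + j - (m + j) / 2, by omega, by omega, by omega⟩
  have hNm : ((m + j : ℕ) : ℝ) = m + j := by push_cast; ring
  have hNab : ((m + j : ℕ) : ℝ) = a + b := by rw [hab]; push_cast; ring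
  set N : ℝ := ((m + j : ℕ) : ℝ) with hN
  have hN1 : 1 ≤ N := by rw [hN]; exact_mod_cast hmj
  have hs : 1 ≤ √N := Real.one_le_sqrt.2 hN1
  have hs0 : 0 < √N := by linarith
  set l := 1 / √N with hl
  have hl0 : 0 ≤ l := by positivity
  have hl1 : l ≤ 1 := by rw [hl, div_le_one hs0]; exact hs
  have hl2 : l ^ 2 = 1 / N := by rw [hl, div_pow, Real.sq_sqrt (by linarith), one_pow]
  have hexp (i : ℕ) (hi : (i : ℝ) ≤ N) : Real.exp (i * (l ^ 2 * v)) ≤ Real.exp v := by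
    refine Real.exp_le_exp.2 ?_
    rw [hl2]
    calc (i : ℝ) * (1 / N * v) = i / N * v := by ring
      _ ≤ 1 * v := by
        gcongr
        rw [div_le_one (by linarith)]
        exact hi
      _ = v := one_mul v
  have hsq (i : ℕ) (hi : N ≤ 2 * ((i : ℝ) + 1)) : C / √((i : ℝ) + 1) ≤ C * √2 / √N := by
    rw [div_le_div_iff₀ (by positivity) hs0, mul_assoc, ← Real.sqrt_mul (by norm_num)]
    gcongr
  have hcoeff : coeff j (PowerSeries.mk p ^ (m + j)) =
      ∑ x ∈ Finset.HasAntidiagonal.antidiagonal j,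
        coeff x.1 (PowerSeries.mk p ^ a) * coeff x.2 (PowerSeries.mk p ^ b) := by
    rw [hab, pow_add, coeff_mul]
  let α : ℕ → ℕ → ℝ := fun n i => coeff i (PowerSeries.mk p ^ n) * Real.exp (l * ((n : ℝ) - i))
  have hα (n i : ℕ) : 0 ≤ α n i := mul_nonneg (hp.coeff_pow_nonneg n i) (Real.exp_pos _).le
  have hhalf (n n' : ℕ) (hn : (n : ℝ) ≤ N) (hn' : N ≤ 2 * ((n' : ℝ) + 1)) :
      ∑ x ∈ Finset.HasAntidiagonal.antidiagonal j,
        α n x.1 * coeff x.2 (PowerSeries.mk p ^ n') ≤ Real.exp v * (C * √2 / √N) := by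
    have h := hp.tsum_coeff_pow_mul_exp_le hl0 hl1 n
    exact sum_antidiagonal_mul_le (hα n) (by positivity)
      (fun i => (hbound n' i).trans (hsq n' hn')) h.1 (h.2.trans (hexp n hn)) j
  have haN : (a : ℝ) ≤ N := by rw [hNab]; linarith [(b.cast_nonneg : (0 : ℝ) ≤ b)]
  have hbN : (b : ℝ) ≤ N := by rw [hNab]; linarith [(a.cast_nonneg : (0 : ℝ) ≤ a)]
  have hA := hhalf a b haN (by rw [hN]; exact_mod_cast hb)
  have hB := hhalf b a hbN (by rw [hN]; exact_mod_cast ha)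
  rw [← Finset.Nat.sum_antidiagonal_swap] at hB
  calc Real.exp (m / √N / 2) * coeff j (PowerSeries.mk p ^ (m + j))
      ≤ ∑ x ∈ Finset.HasAntidiagonal.antidiagonal j,
          (α a x.1 * coeff x.2 (PowerSeries.mk p ^ b) +
            α b x.2 * coeff x.1 (PowerSeries.mk p ^ a)) := by
        rw [hcoeff, Finset.mul_sum]
        refine Finset.sum_le_sum fun x hx => ?_
        have hxj : (x.1 : ℝ) + x.2 = j := by
          exact_mod_cast Finset.HasAntidiagonal.mem_antidiagonal.1 hx
        have hE : Real.exp (m / √N / 2) ≤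
            Real.exp (l * ((a : ℝ) - x.1)) + Real.exp (l * ((b : ℝ) - x.2)) := by
          have hm : (m : ℝ) / √N / 2 = l * (m / 2) := by rw [hl]; ring
          rw [hm]
          rcases le_total ((m : ℝ) / 2) ((a : ℝ) - x.1) with h | h
          · have := Real.exp_le_exp.2 (mul_le_mul_of_nonneg_left h hl0)
            linarith [Real.exp_pos (l * ((b : ℝ) - x.2))]
          · have h' : (m : ℝ) / 2 ≤ (b : ℝ) - x.2 := by linarith
            have := Real.exp_le_exp.2 (mul_le_mul_of_nonneg_left h' hl0)
            linarith [Real.exp_pos (l * ((a : ℝ) - x.1))]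
        have := mul_le_mul_of_nonneg_right hE (mul_nonneg (hp.coeff_pow_nonneg a x.1)
          (hp.coeff_pow_nonneg b x.2))
        simp only [α]
        linarith
    _ ≤ Real.exp v * (C * √2 / √N) + Real.exp v * (C * √2 / √N) := by
        rw [Finset.sum_add_distrib]
        exact add_le_add hA hB
    _ = _ := by ring

lemma exists_pow_mul_coeff_pow_le (hp : IsCriticalOffspring p) (R : ℕ) :
    ∃ C : ℝ, 0 < C ∧ ∀ m j : ℕ, 0 < m + j →
      (m : ℝ) ^ R * coeff j (PowerSeries.mk p ^ (m + j)) * √(m + j : ℕ) ≤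
        C * √(m + j : ℕ) ^ R := by
  obtain ⟨C, hC, h⟩ := hp.exists_exp_mul_coeff_pow_le
  refine ⟨2 ^ R * R.factorial * C, by positivity, fun m j hmj => ?_⟩
  have hs : 0 < √((m + j : ℕ) : ℝ) := Real.sqrt_pos.2 (by exact_mod_cast hmj)
  have hb := h m j hmj
  set s := √((m + j : ℕ) : ℝ)
  set c := coeff j (PowerSeries.mk p ^ (m + j)) with hc
  have hc0 : 0 ≤ c := hp.coeff_pow_nonneg _ _
  rw [le_div_iff₀ hs] at hb
  have hpow := Real.pow_div_factorial_le_exp (m / s / 2) (by positivity) R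
  rw [div_le_iff₀ (by positivity)] at hpow
  calc (m : ℝ) ^ R * c * s = 2 ^ R * s ^ R * ((m / s / 2) ^ R * (c * s)) := by
        rw [div_pow, div_pow]
        field_simp
    _ ≤ 2 ^ R * s ^ R * (Real.exp (m / s / 2) * R.factorial * (c * s)) := by gcongr
    _ = 2 ^ R * s ^ R * R.factorial * (Real.exp (m / s / 2) * c * s) := by ring
    _ ≤ 2 ^ R * s ^ R * R.factorial * C := by gcongr
    _ = _ := by ring

end IsCriticalOffspring

lemma probSize_eq_sizeConv (p : ℕ → ℝ≥0∞) (n : ℕ) :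
    probSize p n = sizeConv p (indicatorNat n) 0 := by
  refine tsum_congr fun t => ?_
  simp [indicatorNat]

lemma natCast_mul_probSize (p : ℕ → ℝ≥0∞) {n : ℕ} (hn : 1 ≤ n) :
    (n : ℝ≥0∞) * probSize p n = PowerSeries.coeff (n - 1) (PowerSeries.mk p ^ n) := by
  have h := sizeConv_iterate_indicatorNat p 1 (n - 1) 0
  rw [zero_add, Nat.add_sub_cancel' hn, Nat.cast_one, one_mul] at h
  rw [probSize_eq_sizeConv]
  exact h

lemma exists_pos_forall_le_of_eventually {f : ℕ → ℝ} (hf : ∀ n, 0 ≤ f n) {c : ℝ} (hc : 0 < c)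
    (h : ∀ᶠ n in atTop, f n ≠ 0 → c ≤ f n) : ∃ c, 0 < c ∧ ∀ n, f n ≠ 0 → c ≤ f n := by
  obtain ⟨N, hN⟩ := eventually_atTop.1 h
  clear h
  induction N generalizing c with
  | zero => exact ⟨c, hc, fun n => hN n n.zero_le⟩
  | succ N ih =>
    by_cases h0 : f N = 0
    · refine ih hc fun n hn hfn => hN n (Nat.lt_of_le_of_ne hn ?_) hfn
      rintro rfl
      exact hfn h0
    · refine ih (c := min c (f N)) (lt_min hc ((hf N).lt_of_ne' h0)) fun n hn hfn => ?_
      rcases hn.eq_or_lt with rfl | hn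
      · exact min_le_right _ _
      · exact (min_le_left _ _).trans (hN n hn hfn)

lemma isCriticalOffspring_toReal (p : ℕ → ℝ≥0∞) (hp : ∑' k, p k = 1)
    (hmean : ∑' k : ℕ, (k : ℝ≥0∞) * p k = 1) (hvar_pos : 0 < xiVar p)
    (hvar_fin : xiVar p ≠ ⊤) : IsCriticalOffspring fun k => (p k).toReal where
  nonneg _ := ENNReal.toReal_nonneg
  hasSum_one := by
    have h : ∑' k, p k ≠ ⊤ := by rw [hp]; exact ENNReal.one_ne_top
    simpa [← ENNReal.tsum_toReal_eq (ENNReal.ne_top_of_tsum_ne_top h), hp]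
      using (ENNReal.summable_toReal h).hasSum
  hasSum_mean := by
    have h : ∑' k : ℕ, (k : ℝ≥0∞) * p k ≠ ⊤ := by rw [hmean]; exact ENNReal.one_ne_top
    have := (ENNReal.summable_toReal h).hasSum
    rw [← ENNReal.tsum_toReal_eq (ENNReal.ne_top_of_tsum_ne_top h), hmean] at this
    simpa using this
  summable_sq := by
    have := ENNReal.summable_toReal hvar_fin
    simpa [ENNReal.toReal_ofReal (sq_nonneg _)] using this
  exists_ne_one := by
    by_contra! h
    refine hvar_pos.ne' (ENNReal.tsum_eq_zero.2 fun k => ?_)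
    have h1 : ∑' k, p k ≠ ⊤ := by rw [hp]; exact ENNReal.one_ne_top
    rcases eq_or_ne k 1 with rfl | hk
    · simp
    · rw [((ENNReal.toReal_eq_zero_iff _).1 (h k hk)).resolve_right
        (ENNReal.ne_top_of_tsum_ne_top h1 k), zero_mul]

namespace IsCriticalOffspring

variable {p : ℕ → ℝ}

lemma coeff_mk_ofReal_pow (hp : IsCriticalOffspring p) (n j : ℕ) :
    PowerSeries.coeff j (PowerSeries.mk (fun k => ENNReal.ofReal (p k)) ^ n) =
      ENNReal.ofReal (PowerSeries.coeff j (PowerSeries.mk p ^ n)) := by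
  induction n generalizing j with
  | zero => simp only [pow_zero, PowerSeries.coeff_one]; split_ifs <;> simp
  | succ n ih =>
    rw [pow_succ, pow_succ, PowerSeries.coeff_mul, PowerSeries.coeff_mul,
      ENNReal.ofReal_sum_of_nonneg fun x _ => mul_nonneg (hp.coeff_pow_nonneg _ _) (by
        rw [PowerSeries.coeff_mk]; exact hp.nonneg _)]
    refine Finset.sum_congr rfl fun x _ => ?_
    rw [ih, ENNReal.ofReal_mul (hp.coeff_pow_nonneg _ _), PowerSeries.coeff_mk,
      PowerSeries.coeff_mk]

lemma exists_ofReal_le_mul_probSize (hp : IsCriticalOffspring p) :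
    ∃ c, 0 < c ∧ ∀ n : ℕ, 1 ≤ n → probSize (fun k => ENNReal.ofReal (p k)) n ≠ 0 →
      ENNReal.ofReal c ≤
        ENNReal.ofReal (√n ^ 3) * probSize (fun k => ENNReal.ofReal (p k)) n := by
  obtain ⟨c, hc, h⟩ := hp.eventually_le_coeff_pow
  obtain ⟨c, hc, h⟩ := exists_pos_forall_le_of_eventually
    (f := fun n : ℕ => √n * PowerSeries.coeff (n - 1) (PowerSeries.mk p ^ n))
    (fun n => mul_nonneg (Real.sqrt_nonneg _) (hp.coeff_pow_nonneg _ _)) hc (by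
      filter_upwards [h, eventually_gt_atTop 0] with n hn hpos hne
      have := hn (right_ne_zero_of_mul hne)
      rwa [div_le_iff₀' (by positivity)] at this)
  refine ⟨c, hc, fun n hn hne => ?_⟩
  have hmul := natCast_mul_probSize (fun k => ENNReal.ofReal (p k)) hn
  rw [hp.coeff_mk_ofReal_pow] at hmul
  have hcoeff : PowerSeries.coeff (n - 1) (PowerSeries.mk p ^ n) ≠ 0 := by
    intro h0
    rw [h0, ENNReal.ofReal_zero, mul_eq_zero, Nat.cast_eq_zero] at hmul
    exact hmul.elim (by omega) hne
  have hsq : √(n : ℝ) ^ 3 = √n * n := by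
    rw [pow_succ', Real.sq_sqrt n.cast_nonneg]
  rw [hsq, ENNReal.ofReal_mul (Real.sqrt_nonneg _), ENNReal.ofReal_natCast, mul_assoc, hmul,
    ← ENNReal.ofReal_mul (Real.sqrt_nonneg _)]
  have hpos : 0 < √(n : ℝ) := by positivity
  exact ENNReal.ofReal_le_ofReal (h n (mul_ne_zero hpos.ne' hcoeff))

lemma exists_sizeConv_iterate_mul_pow_le (hp : IsCriticalOffspring p) (Q : ℕ) :
    ∃ C, 0 < C ∧ ∀ n m s : ℕ,
      (sizeConv fun k => ENNReal.ofReal (p k))^[m] (indicatorNat n) s * (m : ℝ≥0∞) ^ (Q + 3) ≤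
        m * ENNReal.ofReal (C * √n ^ Q) := by
  obtain ⟨C, hC, h⟩ := hp.exists_pow_mul_coeff_pow_le (Q + 3)
  refine ⟨C, hC, fun n m s => ?_⟩
  rcases Nat.eq_zero_or_pos m with rfl | hm
  · simp
  rcases lt_or_ge n (s + m) with hlt | hge
  · rw [sizeConv_iterate_indicatorNat_eq_zero _ hlt, zero_mul]
    exact zero_le
  obtain ⟨j, rfl⟩ : ∃ j, n = s + (m + j) := ⟨n - (s + m), by omega⟩
  have hF := sizeConv_iterate_indicatorNat (fun k => ENNReal.ofReal (p k)) m j s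
  rw [hp.coeff_mk_ofReal_pow] at hF
  have hl : 0 < m + j := by omega
  have hbound : (m : ℝ) ^ (Q + 3) * PowerSeries.coeff j (PowerSeries.mk p ^ (m + j)) ≤
      (m + j : ℕ) * (C * √(s + (m + j) : ℕ) ^ Q) := by
    have hpos : 0 < √((m + j : ℕ) : ℝ) := by positivity
    refine le_of_mul_le_mul_right ((h m j hl).trans ?_) hpos
    have hmono : √((m + j : ℕ) : ℝ) ≤ √((s + (m + j) : ℕ) : ℝ) :=
      Real.sqrt_le_sqrt (by exact_mod_cast Nat.le_add_left _ _)
    calc C * √((m + j : ℕ) : ℝ) ^ (Q + 3)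
        = √((m + j : ℕ) : ℝ) ^ 2 * (C * √((m + j : ℕ) : ℝ) ^ Q) * √((m + j : ℕ) : ℝ) := by ring
      _ ≤ (m + j : ℕ) * (C * √(s + (m + j) : ℕ) ^ Q) * √((m + j : ℕ) : ℝ) := by
        rw [Real.sq_sqrt (Nat.cast_nonneg _)]
        gcongr
  refine (ENNReal.mul_le_mul_iff_right (a := ((m + j : ℕ) : ℝ≥0∞)) (by exact_mod_cast hl.ne')
    (ENNReal.natCast_ne_top _)).1 ?_
  rw [← mul_assoc, hF, mul_left_comm, mul_assoc, ← ENNReal.ofReal_natCast m,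
    ← ENNReal.ofReal_natCast (m + j), ← ENNReal.ofReal_pow m.cast_nonneg,
    ← ENNReal.ofReal_mul (Nat.cast_nonneg _), ← ENNReal.ofReal_mul (hp.coeff_pow_nonneg _ _),
    mul_comm (PowerSeries.coeff _ _)]
  gcongr

/-- The moments of the level counts, restricted to trees of a given size. -/
lemma exists_tsum_levelCount_pow_le (hp : IsCriticalOffspring p) (Q : ℕ) :
    ∃ C, 0 < C ∧ ∀ k n : ℕ,
      (∑' t : PlaneTree, if PlaneTree.size t = n then
        gwProb (fun k => ENNReal.ofReal (p k)) t * (levelCount t k : ℝ≥0∞) ^ (Q + 3) else 0) ≤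
        ENNReal.ofReal (C * √n ^ Q) := by
  obtain ⟨C, hC, h⟩ := hp.exists_sizeConv_iterate_mul_pow_le Q
  refine ⟨C, hC, fun k n => ?_⟩
  have hone : ∑' k, ENNReal.ofReal (p k) = 1 := by
    rw [← ENNReal.ofReal_tsum_of_nonneg hp.nonneg hp.hasSum_one.summable, hp.hasSum_one.tsum_eq,
      ENNReal.ofReal_one]
  have hmean : ∑' k : ℕ, (k : ℝ≥0∞) * ENNReal.ofReal (p k) = 1 := by
    simp_rw [← ENNReal.ofReal_natCast, ← ENNReal.ofReal_mul (Nat.cast_nonneg _)]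
    rw [← ENNReal.ofReal_tsum_of_nonneg (fun k => mul_nonneg k.cast_nonneg (hp.nonneg k))
      hp.hasSum_mean.summable, hp.hasSum_mean.tsum_eq, ENNReal.ofReal_one]
  have hlevel := levelConv_iterate_le _ hone hmean
    (fun x => indicatorNat n x.1 * (x.2 : ℝ≥0∞) ^ (Q + 3)) (ENNReal.ofReal (C * √n ^ Q))
    (fun m s => by
      rw [levelConv_zero_iterate _ (indicatorNat n) (fun z => (z : ℝ≥0∞) ^ (Q + 3)), zero_add]
      exact h n m s) k 1 0
  rw [Nat.cast_one, one_mul] at hlevel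
  refine le_trans (le_of_eq (tsum_congr fun t => ?_)) hlevel
  simp [indicatorNat]

end IsCriticalOffspring

lemma Real.rpow_le_one_add_pow {x r : ℝ} (hx : 0 ≤ x) (hr : 0 ≤ r) {R : ℕ} (hR : r ≤ R) :
    x ^ r ≤ 1 + x ^ R := by
  rcases le_total x 1 with h | h
  · exact (Real.rpow_le_one hx h hr).trans (le_add_of_nonneg_right (pow_nonneg hx R))
  · rw [← Real.rpow_natCast]
    exact (Real.rpow_le_rpow_of_exponent_le h hR).trans (le_add_of_nonneg_left zero_le_one)

lemma ENNReal.natCast_rpow_le {r : ℝ} (hr : 0 ≤ r) {R : ℕ} (hR : r ≤ R) (z : ℕ) {n : ℕ}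
    (hn : 1 ≤ n) :
    (z : ℝ≥0∞) ^ r ≤ ENNReal.ofReal ((n : ℝ) ^ (r / 2)) *
      (1 + (z : ℝ≥0∞) ^ R * ENNReal.ofReal ((√n ^ R)⁻¹)) := by
  have hpos : 0 < √(n : ℝ) := by positivity
  have hsqrt : √(n : ℝ) ^ r = (n : ℝ) ^ (r / 2) := by
    rw [Real.sqrt_eq_rpow, ← Real.rpow_mul n.cast_nonneg]
    ring_nf
  rw [← ENNReal.ofReal_natCast z, ENNReal.ofReal_rpow_of_nonneg z.cast_nonneg hr,
    ← ENNReal.ofReal_pow z.cast_nonneg, ← ENNReal.ofReal_mul (by positivity),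
    ← ENNReal.ofReal_one, ← ENNReal.ofReal_add zero_le_one (by positivity),
    ← ENNReal.ofReal_mul (by positivity)]
  refine ENNReal.ofReal_le_ofReal ?_
  have h := Real.rpow_le_one_add_pow (div_nonneg z.cast_nonneg hpos.le) hr hR
  rwa [Real.div_rpow z.cast_nonneg hpos.le, hsqrt, div_le_iff₀' (by positivity), div_pow,
    div_eq_mul_inv] at h

/-- Lemma 4 of Devroye–Janson.  For every `r > 0` there is a constant
`C(r) > 0` such that `E[Z_k(T_n)^r] ≤ C(r) n^{r/2}` for all `k ≥ 0` and `n ≥ 1`. -/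
theorem expected_levelCount_rpow_le
    (p : ℕ → ℝ≥0∞) (hp : ∑' k : ℕ, p k = 1)
    (hmean : ∑' k : ℕ, (k : ℝ≥0∞) * p k = 1)
    (hvar_pos : 0 < xiVar p) (hvar_fin : xiVar p ≠ ⊤) :
    ∀ r : ℝ, 0 < r → ∃ C : ℝ, 0 < C ∧ ∀ k n : ℕ, 1 ≤ n → probSize p n ≠ 0 →
      condExp p n (fun t => (levelCount t k : ℝ≥0∞) ^ r)
        ≤ ENNReal.ofReal (C * (n : ℝ) ^ (r / 2)) := by
  intro r hr
  have hcrit := isCriticalOffspring_toReal p hp hmean hvar_pos hvar_fin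
  have htop : ∑' k, p k ≠ ⊤ := by rw [hp]; exact ENNReal.one_ne_top
  have hpP : (fun k => ENNReal.ofReal (p k).toReal) = p :=
    funext fun k => ENNReal.ofReal_toReal (ENNReal.ne_top_of_tsum_ne_top htop k)
  obtain ⟨A, hA, hmoment⟩ := hcrit.exists_tsum_levelCount_pow_le ⌈r⌉₊
  obtain ⟨c, hc, hlower⟩ := hcrit.exists_ofReal_le_mul_probSize
  rw [hpP] at hmoment hlower
  refine ⟨1 + A / c, by positivity, fun k n hn hne => ENNReal.div_le_of_le_mul ?_⟩
  set R := ⌈r⌉₊ + 3 with hR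
  have hrR : r ≤ R := (Nat.le_ceil r).trans (by exact_mod_cast Nat.le_add_right _ _)
  have hpos : 0 < √(n : ℝ) := by positivity
  have hscale : ENNReal.ofReal (A * √n ^ ⌈r⌉₊) * ENNReal.ofReal ((√n ^ R)⁻¹) ≤
      ENNReal.ofReal (A / c) * probSize p n := by
    have h : A * √(n : ℝ) ^ ⌈r⌉₊ * (√n ^ R)⁻¹ = A / c * ((√n ^ 3)⁻¹ * c) := by
      rw [hR, pow_add]
      field_simp
    rw [← ENNReal.ofReal_mul (by positivity), h, ENNReal.ofReal_mul (by positivity),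
      ENNReal.ofReal_mul (by positivity)]
    gcongr
    refine (mul_le_mul_right (hlower n hn hne) _).trans_eq ?_
    rw [← mul_assoc, ← ENNReal.ofReal_mul (by positivity), inv_mul_cancel₀ (by positivity),
      ENNReal.ofReal_one, one_mul]
  calc (∑' t : PlaneTree, if PlaneTree.size t = n then
          gwProb p t * (levelCount t k : ℝ≥0∞) ^ r else 0)
      ≤ ∑' t : PlaneTree, ENNReal.ofReal ((n : ℝ) ^ (r / 2)) *
          ((if PlaneTree.size t = n then gwProb p t else 0) +
            (if PlaneTree.size t = n then gwProb p t * (levelCount t k : ℝ≥0∞) ^ R else 0) *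
              ENNReal.ofReal ((√n ^ R)⁻¹)) := by
        refine ENNReal.tsum_le_tsum fun t => ?_
        split_ifs
        · refine (mul_le_mul_right
            (ENNReal.natCast_rpow_le hr.le hrR (levelCount t k) hn) _).trans_eq ?_
          ring
        · exact zero_le
    _ = ENNReal.ofReal ((n : ℝ) ^ (r / 2)) * (probSize p n +
          (∑' t : PlaneTree, if PlaneTree.size t = n then
            gwProb p t * (levelCount t k : ℝ≥0∞) ^ R else 0) *
              ENNReal.ofReal ((√n ^ R)⁻¹)) := by
        rw [ENNReal.tsum_mul_left, ENNReal.tsum_add, ENNReal.tsum_mul_right, probSize]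
    _ ≤ ENNReal.ofReal ((n : ℝ) ^ (r / 2)) *
          (probSize p n + ENNReal.ofReal (A / c) * probSize p n) := by
        gcongr _ * (_ + ?_)
        exact (mul_le_mul_left (hmoment k n) _).trans hscale
    _ = ENNReal.ofReal ((1 + A / c) * (n : ℝ) ^ (r / 2)) * probSize p n := by
        rw [ENNReal.ofReal_mul (by positivity), ENNReal.ofReal_add zero_le_one (by positivity),
          ENNReal.ofReal_one]
        ring
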